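/- arXiv:2408.11661 — 2 statements merged into one kernel-verified Lean document; each statement's English description precedes it below -/
import Mathlib

section
/- For every finite coloring of the positive integers ℕ there exists λ ∈ ℕ such that for every k ∈ ℕ there exist a finite nonempty subset A of ℕ containing a k-AP, a k-GP, a k-FS and a k-FP, and a subset B of ℕ that is central both in (ℕ,+) and in (ℕ,·), such that the set (λ+A) ∪ (λ+B) ∪ (λ+AB) ∪ (A+B) is monochromatic. -/
/-- Ordered fold of `op` over the values of `a` along the increasing index list `i :: l`. -/
def foldSeq {S : Type*} (op : S → S → S) (a : ℕ → S) : ℕ → List ℕ → S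
  | i, [] => a i
  | i, j :: l => op (a i) (foldSeq op a j l)

/-- `FSIcc op a m n` is the set of "finite sums" (with respect to the operation `op`)
`a α₁ ⋆ a α₂ ⋆ ⋯ ⋆ a αₖ` over nonempty subsets `{α₁ < α₂ < ⋯ < αₖ}` of `{m, …, n}`. -/
def FSIcc {S : Type*} (op : S → S → S) (a : ℕ → S) (m n : ℕ) : Set S :=
  { s | ∃ (i : ℕ) (l : List ℕ), List.Chain (· < ·) i l ∧
      (∀ j ∈ i :: l, m ≤ j ∧ j ≤ n) ∧ s = foldSeq op a i l }

/-- `p` is an idempotent ultrafilter in `(βS, +)`. -/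
def IsAddIdempotent {S : Type*} [Add S] (p : Ultrafilter S) : Prop :=
  ∀ A : Set S, A ∈ p ↔ {s | {t | s + t ∈ A} ∈ p} ∈ p

/-- `p ≤_L q`, i.e. `p = p + q`, expressed via membership. -/
def AddLeL {S : Type*} [Add S] (p q : Ultrafilter S) : Prop :=
  ∀ A : Set S, A ∈ p ↔ {s | {t | s + t ∈ A} ∈ q} ∈ p

/-- `p` is a minimal idempotent in `(βS, +)` with respect to the order `≤_L`. -/
def IsMinimalAddIdempotent {S : Type*} [Add S] (p : Ultrafilter S) : Prop :=
  IsAddIdempotent p ∧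
    ∀ q : Ultrafilter S, IsAddIdempotent q → AddLeL q p → AddLeL p q

/-- A set is central in `(S, +)` if it belongs to some minimal idempotent of `(βS, +)`. -/
def AddCentral {S : Type*} [Add S] (A : Set S) : Prop :=
  ∃ p : Ultrafilter S, IsMinimalAddIdempotent p ∧ A ∈ p

/-- `p` is an idempotent ultrafilter in `(βS, ·)`. -/
def IsMulIdempotent {S : Type*} [Mul S] (p : Ultrafilter S) : Prop :=
  ∀ A : Set S, A ∈ p ↔ {s | {t | s * t ∈ A} ∈ p} ∈ p

/-- `p ≤_L q`, i.e. `p = p · q`, expressed via membership. -/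
def MulLeL {S : Type*} [Mul S] (p q : Ultrafilter S) : Prop :=
  ∀ A : Set S, A ∈ p ↔ {s | {t | s * t ∈ A} ∈ q} ∈ p

/-- `p` is a minimal idempotent in `(βS, ·)` with respect to the order `≤_L`. -/
def IsMinimalMulIdempotent {S : Type*} [Mul S] (p : Ultrafilter S) : Prop :=
  IsMulIdempotent p ∧
    ∀ q : Ultrafilter S, IsMulIdempotent q → MulLeL q p → MulLeL p q

/-- A set is central in `(S, ·)` if it belongs to some minimal idempotent of `(βS, ·)`. -/
def MulCentral {S : Type*} [Mul S] (A : Set S) : Prop :=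
  ∃ p : Ultrafilter S, IsMinimalMulIdempotent p ∧ A ∈ p

attribute [local instance] Ultrafilter.semigroup Ultrafilter.addSemigroup

section Semigroup

variable {S : Type*}

theorem mulLeL_iff_mul_eq [Semigroup S] {p q : Ultrafilter S} : MulLeL p q ↔ p * q = p := by
  rw [Ultrafilter.ext_iff]
  exact forall_congr' fun _ => Iff.comm

/-- Every nonempty closed left ideal of `(βS, ·)` contains a minimal idempotent. -/
theorem exists_isMinimalMulIdempotent_mem [Semigroup S] {M : Set (Ultrafilter S)}
    (hclosed : IsClosed M) (hne : M.Nonempty) (hideal : ∀ u, ∀ p ∈ M, u * p ∈ M) :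
    ∃ e ∈ M, IsMinimalMulIdempotent e := by
  let I : Set (Set (Ultrafilter S)) :=
    {N | IsClosed N ∧ N.Nonempty ∧ ∀ u, ∀ p ∈ N, u * p ∈ N}
  obtain ⟨N, hNM, hN⟩ := zorn_superset_nonempty I (by
    intro c hcI hc hcne
    refine ⟨⋂₀ c, ⟨isClosed_sInter fun t ht => (hcI ht).1, ?_, ?_⟩,
      fun s hs => Set.sInter_subset_of_mem hs⟩
    · have : Nonempty c := hcne.to_subtype
      exact IsCompact.nonempty_sInter_of_directed_nonempty_isCompact_isClosed
        (fun s hs t ht => (hc.total hs ht).elim (fun h => ⟨s, hs, subset_rfl, h⟩)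
          fun h => ⟨t, ht, h, subset_rfl⟩) (fun t ht => (hcI ht).2.1)
        (fun t ht => (hcI ht).1.isCompact) fun t ht => (hcI ht).1
    · exact fun u p hp t ht => (hcI ht).2.2 u p (hp t ht)) M ⟨hclosed, hne, hideal⟩
  obtain ⟨hNclosed, hNne, hNideal⟩ := hN.prop
  obtain ⟨e, heN, he⟩ := exists_idempotent_in_compact_subsemigroup
    Ultrafilter.continuous_mul_left N hNne hNclosed.isCompact fun x _ y hy => hNideal x y hy
  refine ⟨e, hNM heN, mulLeL_iff_mul_eq.2 he, fun f hf hfe => ?_⟩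
  have hff : f * f = f := mulLeL_iff_mul_eq.1 hf
  have hfN : f ∈ N := mulLeL_iff_mul_eq.1 hfe ▸ hNideal f e heN
  have hrange : Set.range (· * f) ∈ I := by
    refine ⟨(isCompact_range (Ultrafilter.continuous_mul_left f)).isClosed, ⟨_, f, rfl⟩, ?_⟩
    rintro u _ ⟨x, rfl⟩
    exact ⟨u * x, mul_assoc u x f⟩
  have hsub : Set.range (· * f) ⊆ N := by
    rintro _ ⟨x, rfl⟩
    exact hNideal x f hfN
  obtain ⟨x, rfl⟩ := hN.le_of_le hrange hsub heN
  exact mulLeL_iff_mul_eq.2 (by rw [mul_assoc, hff])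

/-- Every nonempty closed left ideal of `(βS, +)` contains a minimal idempotent. -/
theorem exists_isMinimalAddIdempotent_mem [AddSemigroup S] {M : Set (Ultrafilter S)}
    (hclosed : IsClosed M) (hne : M.Nonempty) (hideal : ∀ u, ∀ p ∈ M, u + p ∈ M) :
    ∃ e ∈ M, IsMinimalAddIdempotent e :=
  exists_isMinimalMulIdempotent_mem (S := Multiplicative S) hclosed hne hideal

theorem isClosed_setOf_forall_mem (P : Set S → Prop) :
    IsClosed {p : Ultrafilter S | ∀ A ∈ p, P A} := by
  simp only [Set.ofPred_forall]
  refine isClosed_iInter fun A => ?_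
  by_cases hA : P A
  · simp [hA]
  · simpa only [hA, imp_false] using! (ultrafilter_isOpen_basic A).isClosed_compl

theorem Ultrafilter.exists_preimage_singleton_mem {κ : Type*} [Finite κ] (p : Ultrafilter S)
    (f : S → κ) : ∃ i, f ⁻¹' {i} ∈ p := by
  obtain ⟨i, hi⟩ := Ultrafilter.eq_pure_of_finite (p.map f)
  exact ⟨i, Ultrafilter.mem_map.1 (hi ▸ Ultrafilter.mem_pure.2 rfl)⟩

/-- If some member of every finite cover satisfies `P`, then there is an ultrafilter all of whose
members satisfy `P`. -/
theorem exists_ultrafilter_forall_mem (P : Set S → Prop)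
    (h : ∀ T : Finset (Set S), ⋃₀ (T : Set (Set S)) = Set.univ → ∃ A ∈ T, P A) :
    ∃ p : Ultrafilter S, ∀ A ∈ p, P A := by
  classical
  obtain ⟨p, hp⟩ := Ultrafilter.exists_ultrafilter_of_finite_inter_nonempty {A | ¬ P Aᶜ} (by
    intro T hT
    by_contra hemp
    obtain ⟨A, hA, hPA⟩ := h (T.image compl) (by
      rw [Finset.coe_image, ← Set.compl_sInter, Set.not_nonempty_iff_eq_empty.1 hemp,
        Set.compl_empty])
    obtain ⟨B, hB, rfl⟩ := Finset.mem_image.1 hA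
    exact hT hB hPA)
  refine ⟨p, fun A hA => ?_⟩
  by_contra hPA
  exact Ultrafilter.compl_mem_iff_notMem.1 (hp (show ¬ P Aᶜᶜ by rwa [compl_compl])) hA

theorem foldSeq_mul_mem_FP [Semigroup S] (a : Stream' S) (l : List ℕ) :
    ∀ i, List.IsChain (· < ·) (i :: l) →
      foldSeq (· * ·) a.get i l ∈ Hindman.FP (a.drop i) := by
  induction l with
  | nil =>
    intro i _
    have := Hindman.FP.head (a.drop i)
    rwa [Stream'.head_drop] at this
  | cons j l ih =>
    intro i h
    rw [List.isChain_cons_cons] at h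
    have hmem := ih j h.2
    obtain ⟨m, rfl⟩ := Nat.exists_eq_add_of_le (Nat.succ_le_of_lt h.1)
    rw [← Stream'.drop_drop] at hmem
    have := Hindman.FP.cons (a.drop i) _ (by
      rw [Stream'.tail_drop']
      exact Hindman.FP_drop_subset_FP _ _ hmem)
    rwa [Stream'.head_drop] at this

theorem IsMulIdempotent.exists_FSIcc_subset [Semigroup S] {p : Ultrafilter S}
    (hp : IsMulIdempotent p) {A : Set S} (hA : A ∈ p) :
    ∃ z : ℕ → S, ∀ m n, FSIcc (· * ·) z m n ⊆ A := by
  obtain ⟨a, ha⟩ := Hindman.exists_FP_of_large p (mulLeL_iff_mul_eq.1 hp) A hA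
  refine ⟨a.get, fun m n => ?_⟩
  rintro _ ⟨i, l, hl, -, rfl⟩
  exact ha (Hindman.FP_drop_subset_FP a i (foldSeq_mul_mem_FP a l i hl))

theorem IsAddIdempotent.exists_FSIcc_subset [AddSemigroup S] {p : Ultrafilter S}
    (hp : IsAddIdempotent p) {A : Set S} (hA : A ∈ p) :
    ∃ z : ℕ → S, ∀ m n, FSIcc (· + ·) z m n ⊆ A :=
  IsMulIdempotent.exists_FSIcc_subset (S := Multiplicative S) hp hA

theorem FSIcc_finite (op : S → S → S) (a : ℕ → S) (m n : ℕ) : (FSIcc op a m n).Finite := by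
  have hlists : {L : List ℕ | L.Pairwise (· < ·) ∧ ∀ j ∈ L, m ≤ j ∧ j ≤ n}.Finite := by
    refine Set.Finite.subset
      ((Finset.Icc m n).powerset.finite_toSet.image fun s => s.sort (· ≤ ·)) ?_
    rintro L ⟨hL, hmem⟩
    refine ⟨L.toFinset, ?_, ?_⟩
    · exact Finset.mem_powerset.2 fun j hj => Finset.mem_Icc.2 (hmem j (List.mem_toFinset.1 hj))
    · exact (List.toFinset_sort (· ≤ ·) (hL.imp ne_of_lt)).2 (hL.imp le_of_lt)
  refine (hlists.image fun L => match L with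
    | [] => a 0
    | i :: l => foldSeq op a i l).subset ?_
  rintro _ ⟨i, l, hl, hmem, rfl⟩
  exact ⟨i :: l, ⟨List.isChain_iff_pairwise.1 hl, hmem⟩, rfl⟩

end Semigroup

section Dilation

theorem addLeL_map_mul_left_iff (n : ℕ+) {p q : Ultrafilter ℕ+} :
    AddLeL (p.map (n * ·)) (q.map (n * ·)) ↔ AddLeL p q := by
  constructor
  · intro h A
    have hA := h ((n * ·) '' A)
    simp only [Ultrafilter.mem_map, Set.preimage, Set.mem_ofPred_eq, ← mul_add,
      (mul_right_injective n).mem_set_image] at hA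
    exact hA
  · intro h A
    have hA := h ((n * ·) ⁻¹' A)
    simp only [Set.mem_preimage, mul_add] at hA
    exact hA

theorem IsAddIdempotent.range_mul_left_mem {p : Ultrafilter ℕ+} (hp : IsAddIdempotent p)
    (n : ℕ+) : Set.range (n * ·) ∈ p := by
  obtain ⟨r, hr⟩ := p.exists_preimage_singleton_mem fun x : ℕ+ => ((x : ℕ) : ZMod n)
  obtain ⟨s, hs, hsr⟩ := Ultrafilter.nonempty_of_mem (Filter.inter_mem ((hp _).1 hr) hr)
  obtain ⟨t, ht, htr⟩ := Ultrafilter.nonempty_of_mem (Filter.inter_mem hs hr)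
  simp only [Set.mem_ofPred_eq, Set.mem_preimage, Set.mem_singleton_iff, PNat.add_coe,
    Nat.cast_add] at ht htr hsr
  rw [hsr, htr, add_eq_left] at ht
  subst ht
  filter_upwards [hr] with x hx
  obtain ⟨y, hy⟩ := PNat.dvd_iff.2 ((ZMod.natCast_eq_zero_iff _ _).1 hx)
  exact ⟨y, hy.symm⟩

theorem IsMinimalAddIdempotent.map_mul_left {p : Ultrafilter ℕ+}
    (hp : IsMinimalAddIdempotent p) (n : ℕ+) : IsMinimalAddIdempotent (p.map (n * ·)) := by
  refine ⟨(addLeL_map_mul_left_iff n).2 hp.1, fun q hq hqp => ?_⟩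
  have hrange := hq.range_mul_left_mem n
  have hinj : Function.Injective (n * · : ℕ+ → ℕ+) := mul_right_injective n
  obtain ⟨r, rfl⟩ : ∃ r : Ultrafilter ℕ+, r.map (n * ·) = q :=
    ⟨q.comap hinj hrange, Ultrafilter.coe_injective (by
      rw [Ultrafilter.coe_map, Ultrafilter.coe_comap, Filter.map_comap_of_mem hrange])⟩
  exact (addLeL_map_mul_left_iff n).2
    (hp.2 r ((addLeL_map_mul_left_iff n).1 hq) ((addLeL_map_mul_left_iff n).1 hqp))

theorem AddCentral.of_preimage_mul_left {A : Set ℕ+} (n : ℕ+)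
    (h : AddCentral {t | n * t ∈ A}) : AddCentral A := by
  obtain ⟨p, hp, hA⟩ := h
  exact ⟨p.map (n * ·), hp.map_mul_left n, Ultrafilter.mem_map.2 hA⟩

end Dilation

section Progressions

/-- `A` contains arithmetic progressions of every finite length. -/
def HasLongAPs (A : Set ℕ+) : Prop :=
  ∀ k : ℕ, ∃ a d : ℕ+, ∀ j < k, (fun x => x + d)^[j] a ∈ A

theorem HasLongAPs.of_preimage_add_left {A : Set ℕ+} (n : ℕ+)
    (h : HasLongAPs {t | n + t ∈ A}) : HasLongAPs A := by
  intro k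
  obtain ⟨a, d, had⟩ := h k
  refine ⟨n + a, d, fun j hj => ?_⟩
  have hsemi : Function.Semiconj (n + ·) (· + d) (· + d) := fun x => (add_assoc n x d).symm
  exact (hsemi.iterate_right j a) ▸ had j hj

theorem HasLongAPs.of_preimage_mul_left {A : Set ℕ+} (n : ℕ+)
    (h : HasLongAPs {t | n * t ∈ A}) : HasLongAPs A := by
  intro k
  obtain ⟨a, d, had⟩ := h k
  refine ⟨n * a, n * d, fun j hj => ?_⟩
  have hsemi : Function.Semiconj (n * ·) (· + d) (· + n * d) := fun x => mul_add n x d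
  exact (hsemi.iterate_right j a) ▸ had j hj

theorem coe_iterate_add_right (a d : ℕ+) (j : ℕ) :
    (((fun x => x + d)^[j] a : ℕ+) : ℕ) = a + j * d := by
  induction j with
  | zero => simp
  | succ j ih =>
    rw [Function.iterate_succ_apply', PNat.add_coe, ih]
    ring

/-- Van der Waerden's theorem: some part of every finite cover has long progressions. -/
theorem exists_hasLongAPs_of_sUnion_eq_univ (T : Finset (Set ℕ+))
    (hT : ⋃₀ (T : Set (Set ℕ+)) = Set.univ) : ∃ A ∈ T, HasLongAPs A := by
  by_contra! hcon
  simp only [HasLongAPs] at hcon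
  push Not at hcon
  choose! K hK using hcon
  have hcover : ∀ x : ℕ+, ∃ A : T, x ∈ A.1 := fun x => by
    obtain ⟨A, hA, hx⟩ := Set.mem_sUnion.1 (hT ▸ Set.mem_univ x)
    exact ⟨⟨A, hA⟩, hx⟩
  choose C hC using hcover
  obtain ⟨d, hd, b, A, hA⟩ := Combinatorics.exists_mono_homothetic_copy
    (Finset.range (T.sup K)) fun n : ℕ => C n.succPNat
  obtain ⟨d, rfl⟩ : ∃ d' : ℕ+, (d' : ℕ) = d := ⟨d.toPNat hd, rfl⟩
  obtain ⟨j, hj, hjA⟩ := hK A.1 A.2 b.succPNat d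
  refine hjA ?_
  have hcolor := hA j (Finset.mem_range.2 (hj.trans_le (Finset.le_sup A.2)))
  have heq : (fun x => x + d)^[j] b.succPNat = ((d : ℕ) • j + b).succPNat := by
    apply PNat.coe_injective
    rw [coe_iterate_add_right]
    simp only [Nat.succPNat_coe, smul_eq_mul, Nat.succ_eq_add_one]
    ring
  rw [heq, ← hcolor]
  exact hC _

end Progressions

/-- There is a minimal idempotent of `(βℕ, ·)` all of whose members are additively central and
contain arbitrarily long arithmetic progressions. -/
theorem exists_isMinimalMulIdempotent_forall_addCentral :
    ∃ q : Ultrafilter ℕ+, (∀ A ∈ q, AddCentral A ∧ HasLongAPs A) ∧ IsMinimalMulIdempotent q := by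
  obtain ⟨e, he, hemin⟩ := exists_isMinimalAddIdempotent_mem
    (isClosed_setOf_forall_mem HasLongAPs)
    (exists_ultrafilter_forall_mem HasLongAPs exists_hasLongAPs_of_sUnion_eq_univ)
    (fun u p hp A hA => by
      obtain ⟨n, hn⟩ := Ultrafilter.nonempty_of_mem (f := u) hA
      exact (hp _ hn).of_preimage_add_left n)
  refine exists_isMinimalMulIdempotent_mem
    (isClosed_setOf_forall_mem fun A => AddCentral A ∧ HasLongAPs A)
    ⟨e, fun A hA => ⟨⟨e, hemin, hA⟩, he A hA⟩⟩ (fun u p hp A hA => ?_)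
  obtain ⟨n, hn⟩ := Ultrafilter.nonempty_of_mem (f := u) hA
  exact ⟨(hp _ hn).1.of_preimage_mul_left n, (hp _ hn).2.of_preimage_mul_left n⟩

theorem stmt2 (c : ℕ) (col : ℕ+ → Fin c) :
    ∃ lam : ℕ+, ∀ k : ℕ+,
      ∃ A : Set ℕ+, A.Finite ∧ A.Nonempty ∧
        -- A contains a k-AP
        (∃ a d : ℕ+, ∀ j : ℕ, j < (k : ℕ) → (fun x => x + d)^[j] a ∈ A) ∧
        -- A contains a k-GP
        (∃ a r : ℕ+, ∀ j : ℕ, j < (k : ℕ) → (fun x => x * r)^[j] a ∈ A) ∧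
        -- A contains a k-FS
        (∃ z : ℕ → ℕ+, FSIcc (· + ·) z 1 (k : ℕ) ⊆ A) ∧
        -- A contains a k-FP
        (∃ z : ℕ → ℕ+, FSIcc (· * ·) z 1 (k : ℕ) ⊆ A) ∧
        ∃ B : Set ℕ+, AddCentral B ∧ MulCentral B ∧
          -- (λ+A) ∪ (λ+B) ∪ (λ+AB) ∪ (A+B) is monochromatic
          ∃ i : Fin c, ∀ w : ℕ+,
            w ∈ ({w | ∃ a ∈ A, w = lam + a} ∪ {w | ∃ b ∈ B, w = lam + b} ∪
                  {w | ∃ a ∈ A, ∃ b ∈ B, w = lam + a * b} ∪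
                  {w | ∃ a ∈ A, ∃ b ∈ B, w = a + b} : Set ℕ+) →
              col w = i := by
  obtain ⟨q, hq, hqmin⟩ := exists_isMinimalMulIdempotent_forall_addCentral
  choose χ hχ using fun n : ℕ+ => q.exists_preimage_singleton_mem fun m => col (n + m)
  obtain ⟨i, hi⟩ := q.exists_preimage_singleton_mem χ
  obtain ⟨lam, hlam⟩ := Ultrafilter.nonempty_of_mem hi
  have hshift : ∀ n ∈ χ ⁻¹' {i}, {m | col (n + m) = i} ∈ q := fun n hn => by
    have := hχ n
    rwa [Set.mem_singleton_iff.1 hn] at this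
  have hC : {m | col (lam + m) = i} ∈ q := hshift lam hlam
  have hE : χ ⁻¹' {i} ∩ ({m | col (lam + m) = i} ∩
      {a | {b | col (lam + a * b) = i} ∈ q}) ∈ q :=
    Filter.inter_mem hi (Filter.inter_mem hC ((hqmin.1 _).1 hC))
  set E := χ ⁻¹' {i} ∩ ({m | col (lam + m) = i} ∩ {a | {b | col (lam + a * b) = i} ∈ q})
  refine ⟨lam, fun k => ?_⟩
  obtain ⟨⟨p, hp, hEp⟩, hAP⟩ := hq E hE
  obtain ⟨a, d, had⟩ := hAP k
  obtain ⟨x, hx⟩ := hp.1.exists_FSIcc_subset hEp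
  obtain ⟨y, hy⟩ := hqmin.1.exists_FSIcc_subset hE
  let A : Set ℕ+ := (fun j => (fun x => x + d)^[j] a) '' Set.Iio (k : ℕ) ∪
    (FSIcc (· + ·) x 1 k ∪ FSIcc (· * ·) y 1 k)
  have hAE : A ⊆ E := Set.union_subset (Set.image_subset_iff.2 had)
    (Set.union_subset (hx 1 k) (hy 1 k))
  have hAfin : A.Finite := ((Set.finite_Iio _).image _).union
    ((FSIcc_finite _ _ _ _).union (FSIcc_finite _ _ _ _))
  have haA : a ∈ A := Or.inl ⟨0, k.pos, rfl⟩
  let B : Set ℕ+ := {m | col (lam + m) = i} ∩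
    ⋂ a ∈ A, {b | col (lam + a * b) = i} ∩ {b | col (a + b) = i}
  have hB : B ∈ q := Filter.inter_mem hC ((Filter.biInter_mem hAfin).2 fun a ha =>
    Filter.inter_mem (hAE ha).2.2 (hshift a (hAE ha).1))
  refine ⟨A, hAfin, ⟨a, haA⟩, ⟨a, d, fun j hj => Or.inl ⟨j, hj, rfl⟩⟩,
    ⟨a, 1, fun j _ => ?_⟩, ⟨x, fun w hw => Or.inr (Or.inl hw)⟩,
    ⟨y, fun w hw => Or.inr (Or.inr hw)⟩, B, (hq B hB).1, ⟨q, hqmin, hB⟩, i, ?_⟩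
  · rwa [Function.iterate_fixed (mul_one a)]
  · rintro w (((⟨a, ha, rfl⟩ | ⟨b, hb, rfl⟩) | ⟨a, ha, b, hb, rfl⟩) | ⟨a, ha, b, hb, rfl⟩)
    · exact (hAE ha).2.1
    · exact hb.1
    · exact (Set.mem_iInter₂.1 hb.2 a ha).1
    · exact (Set.mem_iInter₂.1 hb.2 a ha).2
end

section
/- Let (S,+) be a semigroup. For every d ∈ ℕ and every finite coloring of S^d, there is a sequence (a_i)_{i≥0} in S such that the set ⋃ {(x_1,…,x_d) : x_i ∈ FS(a_{m_{i−1}},…,a_{m_i−1}) for each 1 ≤ i ≤ d}, where the union ranges over all integer tuples (m_0,…,m_d) with 0 ≤ m_0 < m_1 < ⋯ < m_d, is monochromatic. -/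
open Filter

section Ultrafilters

attribute [local instance] Ultrafilter.add Ultrafilter.addSemigroup

/-- Every nonempty additive semigroup carries an idempotent ultrafilter. -/
theorem exists_ultrafilter_eventually_add (S : Type*) [AddSemigroup S] [Nonempty S] :
    ∃ U : Ultrafilter S, ∀ p : S → Prop,
      (∀ᶠ x in U, p x) → ∀ᶠ x in U, ∀ᶠ y in U, p (x + y) := by
  obtain ⟨U, hU⟩ := exists_idempotent_of_compact_t2_of_continuous_add_left
    (@Ultrafilter.continuous_add_left S _)
  refine ⟨U, fun p hp => ?_⟩
  rw [← hU] at hp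
  exact (Ultrafilter.eventually_add U U p).1 hp

end Ultrafilters

theorem Ultrafilter.exists_eventually_eq_of_finite {S α : Type*} [Finite α] (U : Ultrafilter S)
    (f : S → α) : ∃ i, ∀ᶠ x in U, f x = i := by
  obtain ⟨i, hi⟩ := (U.map f).eq_pure_of_finite
  refine ⟨i, ?_⟩
  have h : ({i} : Set α) ∈ U.map f := by
    rw [hi]
    exact Set.mem_singleton i
  exact h

/-- The color of almost all extensions of `l` by `k` further entries, in the sense of iterated
limits along the ultrafilter `U`. -/
noncomputable def iteratedLimit {S α : Type*} [Finite α] (U : Ultrafilter S) (f : List S → α) :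
    ℕ → List S → α
  | 0, l => f l
  | k + 1, l =>
      (U.exists_eventually_eq_of_finite fun x => iteratedLimit U f k (x :: l)).choose

theorem eventually_iteratedLimit_eq {S α : Type*} [Finite α] (U : Ultrafilter S)
    (f : List S → α) (k : ℕ) (l : List S) :
    ∀ᶠ x in U, iteratedLimit U f k (x :: l) = iteratedLimit U f (k + 1) l :=
  (U.exists_eventually_eq_of_finite fun x => iteratedLimit U f k (x :: l)).choose_spec

/-- Add `x` on the right to the first entry of a list. -/
def addHead {S : Type*} [Add S] (x : S) : List S → List S
  | [] => []
  | y :: l => (y + x) :: l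

theorem addHead_addHead {S : Type*} [AddSemigroup S] (x z : S) (l : List S) :
    addHead z (addHead x l) = addHead (x + z) l := by
  cases l <;> simp [addHead, add_assoc]

/-- A property of lists that persists under almost every `cons` and almost every `addHead`
holds along all finite stages of a suitable sequence. -/
theorem exists_seq_of_eventually {S : Type*} [AddSemigroup S] (F : Filter S) [F.NeBot]
    (P : List S → Prop) (h_nil : P []) (h_cons : ∀ l, P l → ∀ᶠ x in F, P (x :: l))
    (h_add : ∀ l, P l → ∀ᶠ x in F, P (addHead x l)) :
    ∃ (a : ℕ → S) (T : ℕ → Set (List S)), Monotone T ∧ (∀ n, [] ∈ T n) ∧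
      (∀ n, ∀ l ∈ T n, P l) ∧ (∀ n, ∀ l ∈ T n, a n :: l ∈ T (n + 1)) ∧
      ∀ n, ∀ l ∈ T n, addHead (a n) l ∈ T (n + 1) := by
  let State := {T : Set (List S) // T.Finite ∧ ∀ l ∈ T, P l}
  have h_next : ∀ T : State, ∃ x, ∀ l ∈ T.1, P (x :: l) ∧ P (addHead x l) := fun T =>
    ((eventually_all_finite T.2.1).2 fun l hl =>
      (h_cons l (T.2.2 l hl)).and (h_add l (T.2.2 l hl))).exists
  choose next h_next using h_next
  let step : State → State := fun T =>
    ⟨T.1 ∪ ((next T :: ·) '' T.1 ∪ addHead (next T) '' T.1),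
      T.2.1.union ((T.2.1.image _).union (T.2.1.image _)), by
        rintro l (hl | ⟨l, hl, rfl⟩ | ⟨l, hl, rfl⟩)
        · exact T.2.2 l hl
        · exact (h_next T l hl).1
        · exact (h_next T l hl).2⟩
  let start : State := ⟨{[]}, Set.finite_singleton _, by rintro l rfl; exact h_nil⟩
  let T : ℕ → State := fun n => step^[n] start
  have hT : ∀ n, (T (n + 1)).1 =
      (T n).1 ∪ ((next (T n) :: ·) '' (T n).1 ∪ addHead (next (T n)) '' (T n).1) := fun n => by
    simp only [T, Function.iterate_succ_apply']
    rfl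
  have h_mono : Monotone fun n => (T n).1 := monotone_nat_of_le_succ fun n => by
    rw [hT]
    exact Set.subset_union_left
  refine ⟨fun n => next (T n), fun n => (T n).1, h_mono,
    fun n => h_mono (Nat.zero_le n) (Set.mem_singleton _), fun n => (T n).2.2,
    fun n l hl => ?_, fun n l hl => ?_⟩
  · beta_reduce
    rw [hT]
    exact Or.inr (Or.inl ⟨l, hl, rfl⟩)
  · beta_reduce
    rw [hT]
    exact Or.inr (Or.inr ⟨l, hl, rfl⟩)

section Stages

variable {S : Type*} [AddSemigroup S] {a : ℕ → S} {T : ℕ → Set (List S)}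

theorem add_foldSeq_cons_mem (h_mono : Monotone T)
    (h_add : ∀ n, ∀ l ∈ T n, addHead (a n) l ∈ T (n + 1)) {n : ℕ} {l : List S} (js : List ℕ) :
    ∀ (y : S) (k i : ℕ), y :: l ∈ T k → k ≤ i → List.IsChain (· < ·) (i :: js) →
      (∀ j ∈ i :: js, j ≤ n) → (y + foldSeq (· + ·) a i js) :: l ∈ T (n + 1) := by
  induction js with
  | nil =>
    intro y k i hy hki _ hn
    exact h_mono (Nat.succ_le_succ (hn i (by simp))) (h_add i _ (h_mono hki hy))
  | cons j js ih =>
    intro y k i hy hki hc hn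
    rw [List.isChain_cons_cons] at hc
    have h := ih (y + a i) (i + 1) j (h_add i _ (h_mono hki hy)) hc.1 hc.2
      fun j' hj' => hn j' (List.mem_cons_of_mem _ hj')
    rwa [add_assoc] at h

theorem cons_mem_of_mem_FSIcc (h_mono : Monotone T)
    (h_cons : ∀ n, ∀ l ∈ T n, a n :: l ∈ T (n + 1))
    (h_add : ∀ n, ∀ l ∈ T n, addHead (a n) l ∈ T (n + 1)) {m n : ℕ} {l : List S}
    (hl : l ∈ T m) {s : S} (hs : s ∈ FSIcc (· + ·) a m n) : s :: l ∈ T (n + 1) := by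
  obtain ⟨i, js, hc, hn, rfl⟩ := hs
  have hi : a i :: l ∈ T (i + 1) := h_cons i l (h_mono (hn i (by simp)).1 hl)
  cases js with
  | nil => exact h_mono (Nat.succ_le_succ (hn i (by simp)).2) hi
  | cons j js =>
    replace hc : List.IsChain (· < ·) (i :: j :: js) := hc
    rw [List.isChain_cons_cons] at hc
    exact add_foldSeq_cons_mem h_mono h_add js (a i) (i + 1) j hi hc.1 hc.2
      fun j' hj' => (hn j' (List.mem_cons_of_mem _ hj')).2

end Stages

theorem stmt5 {S : Type*} [AddSemigroup S] [Nonempty S] (d : ℕ) (hd : 0 < d)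
    (c : ℕ) (col : (Fin d → S) → Fin c) :
    ∃ a : ℕ → S, ∃ i0 : Fin c,
      ∀ x : Fin d → S,
        (∃ m : Fin (d + 1) → ℕ, StrictMono m ∧
            ∀ i : Fin d, x i ∈ FSIcc (· + ·) a (m i.castSucc) (m i.succ - 1)) →
          col x = i0 := by
  obtain ⟨U, hU⟩ := exists_ultrafilter_eventually_add S
  let s₀ : S := Classical.arbitrary S
  let f : List S → Fin c := fun l => col fun i => l.reverse.getD i s₀
  let i0 : Fin c := iteratedLimit U f d []
  let Q : List S → Prop := fun l => l.length ≤ d → iteratedLimit U f (d - l.length) l = i0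
  have hQ : ∀ l, Q l → ∀ᶠ x in U, Q (x :: l) := by
    intro l hl
    filter_upwards [eventually_iteratedLimit_eq U f (d - (l.length + 1)) l] with x hx hlen
    rw [List.length_cons] at hlen
    rw [List.length_cons, hx, show d - (l.length + 1) + 1 = d - l.length by omega]
    exact hl (by omega)
  have hQ_nil : Q [] := fun _ => rfl
  obtain ⟨a, T, h_mono, h_nil, hP, h_cons, h_add⟩ := exists_seq_of_eventually (U : Filter S)
    (fun l => Q l ∧ ∀ᶠ x in U, Q (addHead x l))
    ⟨hQ_nil, Eventually.of_forall fun _ => hQ_nil⟩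
    (fun l hl => (hQ l hl.1).and (hU (fun x => Q (x :: l)) (hQ l hl.1)))
    (fun l hl => hl.2.and (by simpa only [addHead_addHead] using hU _ hl.2))
  refine ⟨a, i0, ?_⟩
  rintro x ⟨m, hm, hx⟩
  let y : ℕ → S := fun i => if h : i < d then x ⟨i, h⟩ else s₀
  have h_mem : ∀ k (hk : k ≤ d),
      ((List.range k).map y).reverse ∈ T (m ⟨k, Nat.lt_succ_of_le hk⟩) := by
    intro k
    induction k with
    | zero => exact fun _ => h_nil _
    | succ k ih =>
      intro hk
      have hlt : m (Fin.castSucc ⟨k, hk⟩) < m (Fin.succ ⟨k, hk⟩) := hm Fin.castSucc_lt_succ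
      have h := cons_mem_of_mem_FSIcc h_mono h_cons h_add (ih (by omega)) (hx ⟨k, hk⟩)
      rw [Nat.sub_add_cancel (by omega)] at h
      simpa [List.range_succ, y, Nat.lt_of_succ_le hk] using h
  have h := (hP _ _ (h_mem d le_rfl)).1 (by simp)
  simp only [List.length_reverse, List.length_map, List.length_range, Nat.sub_self] at h
  rw [← h]
  change _ = col _
  congr 1
  funext i
  simp [y]
end
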